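/- Let a, b, c, p, q ∈ ℂ with q ≠ 0 and bc − p(a−p) ≠ 0, and set γ = p(a−p)(b+c−a)/(bc − p(a−p)). Assume none of 1+a−b, 1+a−c, p, a−p, q, γ is a nonpositive integer. Let x be a real number with −1 < x < 3 − 2√2, set δ = (q+(a−q)x)/(1+x), and assume δ is not a nonpositive integer. Then (both series converging absolutely, since |x| < 1 and 4|x| < (1−x)²): ₆F₅(a, b, c, a−p+1, p+1, q+1; 1+a−b, 1+a−c, p, a−p, q; x) = (1 + ((a−q)/q)x) · (1−x)^{−a−1} · ₅F₄(a/2, (a+1)/2, a−b−c, γ+1, δ+1; 1+a−b, 1+a−c, γ, δ; −4x/(1−x)²). -/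

import Mathlib

/-- Rising factorial (Pochhammer symbol) `(a)ₖ = a(a+1)⋯(a+k−1)`. -/
noncomputable def poch (a : ℂ) (k : ℕ) : ℂ := (ascPochhammer ℂ k).eval a

/-- The hypergeometric series `ₘFₗ(A; B; x)` (as a `tsum`). -/
noncomputable def hypF (A B : List ℂ) (x : ℂ) : ℂ :=
  ∑' k : ℕ, (A.map fun a => poch a k).prod /
      ((k.factorial : ℂ) * (B.map fun b => poch b k).prod) * x ^ k

/-- Absolute convergence (= summability in `ℂ`) of the hypergeometric series. -/
def hypSummable (A B : List ℂ) (x : ℂ) : Prop :=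
  Summable fun k : ℕ => (A.map fun a => poch a k).prod /
      ((k.factorial : ℂ) * (B.map fun b => poch b k).prod) * x ^ k

@[simp] lemma poch_zero (a : ℂ) : poch a 0 = 1 := by simp [poch]

lemma poch_succ (a : ℂ) (k : ℕ) : poch a (k + 1) = poch a k * (a + k) :=
  ascPochhammer_succ_eval k a

lemma poch_succ_left (a : ℂ) (k : ℕ) : poch a (k + 1) = a * poch (a + 1) k := by
  simp [poch, ascPochhammer_succ_left]

lemma poch_add (a : ℂ) (m n : ℕ) : poch a (m + n) = poch a m * poch (a + m) n := by
  simp [poch, ← ascPochhammer_mul]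

lemma add_natCast_ne_zero {a : ℂ} (ha : ∀ m : ℕ, a ≠ -(m : ℂ)) (k : ℕ) : a + k ≠ 0 :=
  fun h => ha k (eq_neg_of_add_eq_zero_left h)

lemma poch_ne_zero {a : ℂ} (ha : ∀ m : ℕ, a ≠ -(m : ℂ)) (k : ℕ) : poch a k ≠ 0 := by
  induction k with
  | zero => simp
  | succ k ih => rw [poch_succ]; exact mul_ne_zero ih (add_natCast_ne_zero ha k)

lemma poch_add_one {a : ℂ} (ha : ∀ m : ℕ, a ≠ -(m : ℂ)) (k : ℕ) :
    poch (a + 1) k = poch a k * ((a + k) / a) := by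
  have h0 : a ≠ 0 := by simpa using ha 0
  field_simp
  rw [← poch_succ_left, poch_succ]

lemma poch_two_mul (a : ℂ) (k : ℕ) :
    poch a (2 * k) = 4 ^ k * (poch (a / 2) k * poch ((a + 1) / 2) k) := by
  induction k with
  | zero => simp
  | succ k ih =>
    rw [Nat.mul_succ, poch_succ, poch_succ, ih, poch_succ, poch_succ]
    push_cast
    ring

/-- The summand of the terminating Pfaff–Saalschütz series, in well-poised parameters. -/
noncomputable def saalTerm (a b c : ℂ) (n k : ℕ) : ℂ :=
  (-1) ^ k * (n.choose k : ℂ) * poch (a + n) k * poch (1 + a - b - c) k /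
    (poch (1 + a - b) k * poch (1 + a - c) k)

lemma saalTerm_rec (a b c : ℂ) (hb : ∀ m : ℕ, 1 + a - b ≠ -(m : ℂ))
    (hc : ∀ m : ℕ, 1 + a - c ≠ -(m : ℂ)) (n k : ℕ) :
    (1 + a - b + n) * (1 + a - c + n) * saalTerm a b c (n + 1) (k + 1) -
      (b + n) * (c + n) * saalTerm a b c n (k + 1) =
    (1 + a + 2 * n) * ((-1) ^ (k + 1) * (n.choose (k + 1) : ℂ) * poch (a + n + 1) (k + 1) *
      poch (1 + a - b - c) (k + 2) / (poch (1 + a - b) (k + 1) * poch (1 + a - c) (k + 1))) -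
    (1 + a + 2 * n) * ((-1) ^ k * (n.choose k : ℂ) * poch (a + n + 1) k *
      poch (1 + a - b - c) (k + 1) / (poch (1 + a - b) k * poch (1 + a - c) k)) := by
  have h1 := poch_ne_zero hb k
  have h2 := poch_ne_zero hc k
  have h3 := add_natCast_ne_zero hb k
  have h4 := add_natCast_ne_zero hc k
  have h5 : (n.choose (k + 1) : ℂ) * (k + 1) = n.choose k * (n - k) := by
    rcases le_or_gt k n with h | h
    · rw [← Nat.cast_sub h]; exact_mod_cast Nat.choose_succ_right_eq n k
    · simp [Nat.choose_eq_zero_of_lt h, Nat.choose_eq_zero_of_lt (h.trans (Nat.lt_succ_self k))]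
  have h6 : (k : ℂ) + 1 ≠ 0 := Nat.cast_add_one_ne_zero k
  have h7 : (n.choose (k + 1) : ℂ) = n.choose k * (n - k) / (k + 1) := by
    rw [eq_div_iff h6, h5]
  have h8 : poch (a + n) (k + 1) = (a + n) * poch (a + n + 1) k := poch_succ_left _ _
  have h9 : a + ((n + 1 : ℕ) : ℂ) = a + n + 1 := by push_cast; ring
  simp only [saalTerm, h8, h9, poch_succ _ (k + 1), poch_succ _ k, Nat.choose_succ_succ']
  rw [Nat.cast_add, h7]
  generalize (n.choose k : ℂ) = C
  generalize poch (1 + a - b) k = P at *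
  generalize poch (1 + a - c) k = Q at *
  generalize poch (1 + a - b - c) k = R
  generalize poch (a + n + 1) k = S
  clear hb hc h5 h7 h8 h9
  push_cast
  generalize (n : ℂ) = N at *
  generalize (k : ℂ) = K at *
  field_simp
  ring

/-- The Pfaff–Saalschütz summation. -/
lemma sum_saalTerm (a b c : ℂ) (hb : ∀ m : ℕ, 1 + a - b ≠ -(m : ℂ))
    (hc : ∀ m : ℕ, 1 + a - c ≠ -(m : ℂ)) (n : ℕ) :
    ∑ k ∈ Finset.range (n + 1), saalTerm a b c n k =
      poch b n * poch c n / (poch (1 + a - b) n * poch (1 + a - c) n) := by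
  induction n with
  | zero => simp [saalTerm]
  | succ n ih =>
    have h1 := poch_ne_zero hb n
    have h2 := poch_ne_zero hc n
    have h3 := add_natCast_ne_zero hb n
    have h4 := add_natCast_ne_zero hc n
    have hext : ∑ k ∈ Finset.range (n + 1 + 1), saalTerm a b c n k =
        ∑ k ∈ Finset.range (n + 1), saalTerm a b c n k := by
      rw [Finset.sum_range_succ _ (n + 1)]; simp [saalTerm]
    have key : (1 + a - b + n) * (1 + a - c + n) *
        ∑ k ∈ Finset.range (n + 1 + 1), saalTerm a b c (n + 1) k -
        (b + n) * (c + n) * ∑ k ∈ Finset.range (n + 1 + 1), saalTerm a b c n k = 0 := by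
      rw [Finset.sum_range_succ' _ (n + 1), Finset.sum_range_succ' _ (n + 1)]
      have := Finset.sum_congr (rfl : Finset.range (n + 1) = _)
        fun k _ => saalTerm_rec a b c hb hc n k
      rw [Finset.sum_range_sub (fun k => (1 + a + 2 * n) * ((-1) ^ k * (n.choose k : ℂ) *
        poch (a + n + 1) k * poch (1 + a - b - c) (k + 1) /
          (poch (1 + a - b) k * poch (1 + a - c) k))), Finset.sum_sub_distrib,
        ← Finset.mul_sum, ← Finset.mul_sum] at this
      simp only [saalTerm, Nat.choose_succ_self, poch_succ _ 0] at this ⊢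
      simp only [pow_zero, Nat.choose_zero_right, poch_zero, Nat.cast_zero, Nat.cast_one] at this ⊢
      linear_combination this
    rw [hext, ih] at key
    rw [poch_succ, poch_succ, poch_succ, poch_succ]
    have h5 : (1 + a - b + n) * (1 + a - c + n) ≠ 0 := mul_ne_zero h3 h4
    apply mul_left_cancel₀ h5
    rw [sub_eq_zero.mp key]
    field_simp

/-- The Saalschütz-type evaluation with one extra parameter pair `γ + 1; γ`. -/
lemma sum_saal_extra (a b c p γ : ℂ) (hbc : b * c - p * (a - p) ≠ 0)
    (hγ : γ = p * (a - p) * (b + c - a) / (b * c - p * (a - p))) (hγ0 : γ ≠ 0)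
    (hb : ∀ m : ℕ, 1 + a - b ≠ -(m : ℂ)) (hc : ∀ m : ℕ, 1 + a - c ≠ -(m : ℂ)) (n : ℕ) :
    ∑ k ∈ Finset.range (n + 1), (-1) ^ k * (n.choose k : ℂ) * poch (a + n) k *
        poch (a - b - c) k / (poch (1 + a - b) k * poch (1 + a - c) k) * ((γ + k) / γ) =
      poch b n * poch c n / (poch (1 + a - b) n * poch (1 + a - c) n) *
        ((p + n) * (a - p + n) / (p * (a - p))) := by
  have hu : p * (a - p) ≠ 0 := by rintro h; simp [h] at hγ; exact hγ0 hγ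
  have hd : a - b - c ≠ 0 := by
    intro h
    exact hγ0 (by rw [hγ, show b + c - a = 0 by linear_combination -h]; simp)
  have hd' : b + c - a ≠ 0 := fun h => hd (by linear_combination -h)
  have hratio (k : ℂ) : (γ + k) / γ = 1 + k * (b * c - p * (a - p)) / (p * (a - p) * (b + c - a)) := by
    rw [hγ]; have := left_ne_zero_of_mul hu; have := right_ne_zero_of_mul hu; field_simp
  have hsplit (k : ℕ) : (-1) ^ k * (n.choose k : ℂ) * poch (a + n) k *
        poch (a - b - c) k / (poch (1 + a - b) k * poch (1 + a - c) k) * ((γ + k) / γ) =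
      saalTerm a b c n k - b * c / (p * (a - p)) * ((-1) ^ k * (k * n.choose k : ℂ) *
        poch (a + n) k * (poch (a - b - c) k / (a - b - c)) /
          (poch (1 + a - b) k * poch (1 + a - c) k)) := by
    have h1 := poch_ne_zero hb k
    have h2 := poch_ne_zero hc k
    have h3 : poch (1 + a - b - c) k = poch (a - b - c) k * (a - b - c + k) / (a - b - c) := by
      rw [eq_div_iff hd, ← poch_succ, poch_succ_left, mul_comm]; congr 2; ring
    rw [saalTerm, hratio, h3]
    have := left_ne_zero_of_mul hu; have := right_ne_zero_of_mul hu
    field_simp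
    ring
  rw [Finset.sum_congr rfl fun k _ => hsplit k, Finset.sum_sub_distrib, ← Finset.mul_sum,
    sum_saalTerm a b c hb hc]
  have hb0 : 1 + a - b ≠ 0 := by simpa using hb 0
  have hc0 : 1 + a - c ≠ 0 := by simpa using hc 0
  have hsecond : b * c * ∑ k ∈ Finset.range (n + 1), ((-1) ^ k * (k * n.choose k : ℂ) *
        poch (a + n) k * (poch (a - b - c) k / (a - b - c)) /
          (poch (1 + a - b) k * poch (1 + a - c) k)) =
      -(n * (a + n)) * (poch b n * poch c n / (poch (1 + a - b) n * poch (1 + a - c) n)) := by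
    cases n with
    | zero => simp
    | succ n =>
      have eb : 1 + (a + 2) - (b + 1) = 1 + a - b + 1 := by ring
      have ec : 1 + (a + 2) - (c + 1) = 1 + a - c + 1 := by ring
      have ed : 1 + (a + 2) - (b + 1) - (c + 1) = a - b - c + 1 := by ring
      have hb1 : ∀ m : ℕ, 1 + (a + 2) - (b + 1) ≠ -(m : ℂ) := fun m h =>
        hb (m + 1) (by push_cast; linear_combination h)
      have hc1 : ∀ m : ℕ, 1 + (a + 2) - (c + 1) ≠ -(m : ℂ) := fun m h =>
        hc (m + 1) (by push_cast; linear_combination h)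
      have hs := sum_saalTerm (a + 2) (b + 1) (c + 1) hb1 hc1 n
      rw [Finset.sum_range_succ']
      have hterm (k : ℕ) : ((-1) ^ (k + 1) * ((k + 1 : ℕ) * (n + 1).choose (k + 1) : ℂ) *
          poch (a + (n + 1 : ℕ)) (k + 1) * (poch (a - b - c) (k + 1) / (a - b - c)) /
          (poch (1 + a - b) (k + 1) * poch (1 + a - c) (k + 1))) =
          -((n + 1) * (a + n + 1)) / ((1 + a - b) * (1 + a - c)) *
            saalTerm (a + 2) (b + 1) (c + 1) n k := by
        have h1 := poch_ne_zero hb1 k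
        have h2 := poch_ne_zero hc1 k
        have h5 : (((k + 1 : ℕ) : ℂ) * (n + 1).choose (k + 1) : ℂ) = (n + 1) * n.choose k := by
          rw [mul_comm]; exact_mod_cast (Nat.add_one_mul_choose_eq n k).symm
        have e1 : a + (n + 1 : ℕ) + 1 = a + 2 + (n : ℂ) := by push_cast; ring
        have e2 : a + (n + 1 : ℕ) = a + n + 1 := by push_cast; ring
        rw [saalTerm, h5, poch_succ_left, poch_succ_left, poch_succ_left, poch_succ_left, e1, e2]
        rw [ed, eb, ec]
        rw [eb] at h1; rw [ec] at h2
        field_simp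
        ring
      rw [Finset.sum_congr rfl fun k _ => hterm k, ← Finset.mul_sum, hs, poch_succ_left,
        poch_succ_left, poch_succ_left, poch_succ_left, eb, ec]
      have h1 := poch_ne_zero hb1 n
      have h2 := poch_ne_zero hc1 n
      rw [eb] at h1; rw [ec] at h2
      push_cast
      field_simp
      ring
  rw [div_mul_eq_mul_div, hsecond]
  have h1 := poch_ne_zero hb n
  have h2 := poch_ne_zero hc n
  have := left_ne_zero_of_mul hu; have := right_ne_zero_of_mul hu
  field_simp
  ring

open Filter Topology

lemma tendsto_add_div_add (u v : ℂ) :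
    Tendsto (fun n : ℕ => (u + n) / (v + n)) atTop (𝓝 1) := by
  have h1 : Tendsto (fun n : ℕ => ‖v + n‖) atTop atTop := by
    refine tendsto_atTop_mono (f := fun n : ℕ => (n : ℝ) + -‖v‖) (fun n => ?_)
      (tendsto_atTop_add_const_right _ _ tendsto_natCast_atTop_atTop)
    have := norm_sub_le (v + n) v
    simp at this
    linarith
  have h2 : Tendsto (fun n : ℕ => v + (n : ℂ)) atTop (Bornology.cobounded ℂ) :=
    tendsto_norm_atTop_iff_cobounded.mp h1
  have h3 : Tendsto (fun n : ℕ => 1 + (u - v) * (v + (n : ℂ))⁻¹) atTop (𝓝 (1 + (u - v) * 0)) :=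
    ((tendsto_inv₀_cobounded.comp h2).const_mul _).const_add _
  rw [mul_zero, add_zero] at h3
  refine h3.congr' ?_
  filter_upwards [h1.eventually_gt_atTop 0] with n hn
  have : v + n ≠ 0 := norm_pos_iff.mp hn
  field_simp
  ring

/-- The sequence `c` satisfies `c (n + 1) = ρ n * c n` for large `n`, with `ρ n → 1`. -/
def RatioTendsToOne (c : ℕ → ℂ) : Prop :=
  ∃ ρ : ℕ → ℂ, Tendsto ρ atTop (𝓝 1) ∧ ∀ᶠ n in atTop, c (n + 1) = ρ n * c n

lemma RatioTendsToOne.summable {c : ℕ → ℂ} (hc : RatioTendsToOne c) {z : ℂ} (hz : ‖z‖ < 1) :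
    Summable fun n => c n * z ^ n := by
  obtain ⟨ρ, hρ, h⟩ := hc
  obtain ⟨r, hr, hr1⟩ := exists_between hz
  have hlim : Tendsto (fun n => ‖ρ n * z‖) atTop (𝓝 ‖z‖) := by
    simpa using (hρ.mul_const z).norm
  refine summable_of_ratio_norm_eventually_le hr1 ?_
  filter_upwards [h, hlim.eventually_le_const hr] with n hn hn'
  rw [hn, show ρ n * c n * z ^ (n + 1) = (ρ n * z) * (c n * z ^ n) by ring, norm_mul]
  gcongr

lemma RatioTendsToOne.natCast_mul {c : ℕ → ℂ} (hc : RatioTendsToOne c) :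
    RatioTendsToOne fun n => n * c n := by
  obtain ⟨ρ, hρ, h⟩ := hc
  refine ⟨fun n => (1 + n) / (0 + n) * ρ n, by simpa using (tendsto_add_div_add 1 0).mul hρ, ?_⟩
  filter_upwards [h, eventually_ge_atTop 1] with n hn h1
  have : (n : ℂ) ≠ 0 := by exact_mod_cast (by omega : n ≠ 0)
  rw [hn, zero_add]
  push_cast
  field_simp
  ring

lemma RatioTendsToOne.hasDerivAt {c : ℕ → ℂ} (hc : RatioTendsToOne c) {z : ℂ} (hz : ‖z‖ < 1) :
    HasDerivAt (fun z => ∑' n, c n * z ^ n) (∑' n, c n * (n * z ^ (n - 1))) z := by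
  obtain ⟨r, hr, hr1⟩ := exists_between hz
  have hr0 : 0 < r := (norm_nonneg z).trans_lt hr
  have hs : Summable fun n : ℕ => ‖c n‖ * (n * r ^ (n - 1)) := by
    have h1 := (hc.natCast_mul.summable (z := (r : ℂ)) (by simpa [abs_of_pos hr0])).norm
    refine (h1.mul_right r⁻¹).congr fun n => ?_
    cases n with
    | zero => simp
    | succ n =>
      simp only [norm_mul, norm_pow, Complex.norm_real, Real.norm_eq_abs, abs_of_pos hr0,
        Complex.norm_natCast, Nat.add_sub_cancel]
      field_simp
      ring
  refine hasDerivAt_tsum_of_isPreconnected hs Metric.isOpen_ball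
    (convex_ball (0 : ℂ) r).isPreconnected (y₀ := z)
    (fun n y _ => (hasDerivAt_pow n y).const_mul (c n)) (fun n y hy => ?_)
    (by simpa using hr) (hc.summable hz) (by simpa using hr)
  have hy' : ‖y‖ ≤ r := by simpa using (mem_ball_zero_iff.mp hy).le
  rw [norm_mul, norm_mul, norm_pow, Complex.norm_natCast]
  gcongr

lemma mul_tsum_deriv (c : ℕ → ℂ) (z : ℂ) :
    z * ∑' n : ℕ, c n * (n * z ^ (n - 1)) = ∑' n : ℕ, n * c n * z ^ n := by
  rw [← tsum_mul_left]
  refine tsum_congr fun n => ?_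
  cases n with
  | zero => simp
  | succ n => rw [Nat.add_sub_cancel]; ring

lemma RatioTendsToOne.analyticAt {c : ℕ → ℂ} (hc : RatioTendsToOne c) {z : ℂ} (hz : ‖z‖ < 1) :
    AnalyticAt ℂ (fun z => ∑' n, c n * z ^ n) z := by
  refine DifferentiableOn.analyticAt (s := Metric.ball 0 1) (fun w hw => ?_)
    (Metric.isOpen_ball.mem_nhds (by simpa using hz))
  exact (hc.hasDerivAt (by simpa using hw)).differentiableAt.differentiableWithinAt

lemma hasSum_poch_binomial (s : ℂ) {x : ℂ} (hx : ‖x‖ < 1) :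
    HasSum (fun m : ℕ => poch s m / m.factorial * x ^ m) ((1 - x) ^ (-s)) := by
  have h := (Complex.one_div_one_sub_cpow_hasFPowerSeriesOnBall_zero s).hasSum
    (y := x) (by simpa [enorm_eq_nnnorm, ← NNReal.coe_lt_coe] using hx)
  simp only [zero_add, one_div, ← Complex.cpow_neg] at h
  refine (congrArg (HasSum · ((1 - x) ^ (-s))) (funext fun m => ?_)).mp h
  rw [FormalMultilinearSeries.ofScalars_apply_eq, ← Ring.multichoose_eq]
  have h2 := Ring.factorial_nsmul_multichoose_eq_ascPochhammer s m
  rw [Polynomial.ascPochhammer_smeval_eq_eval, nsmul_eq_mul] at h2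
  rw [poch, ← h2, smul_eq_mul, mul_comm]
  have : (m.factorial : ℂ) ≠ 0 := by exact_mod_cast m.factorial_ne_zero
  field_simp

lemma norm_poch_le {a : ℂ} {α : ℝ} (h : ‖a‖ ≤ α) (k : ℕ) : ‖poch a k‖ ≤ ‖poch (α : ℂ) k‖ := by
  induction k with
  | zero => simp
  | succ k ih =>
    rw [poch_succ, poch_succ, norm_mul, norm_mul]
    gcongr
    have h0 : 0 ≤ α := (norm_nonneg a).trans h
    have h1 : ‖(α : ℂ) + k‖ = α + k := by
      rw [← Complex.ofReal_natCast, ← Complex.ofReal_add, Complex.norm_real, Real.norm_eq_abs,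
        abs_of_nonneg (by positivity)]
    rw [h1]
    refine (norm_add_le _ _).trans ?_
    rw [Complex.norm_natCast]
    gcongr

lemma norm_poch_ofReal {α : ℝ} (h : 0 ≤ α) (k : ℕ) : (‖poch (α : ℂ) k‖ : ℂ) = poch (α : ℂ) k := by
  induction k with
  | zero => simp
  | succ k ih =>
    have h1 : ‖(α : ℂ) + k‖ = α + k := by
      rw [← Complex.ofReal_natCast, ← Complex.ofReal_add, Complex.norm_real, Real.norm_eq_abs,
        abs_of_nonneg (by positivity)]
    rw [poch_succ, norm_mul, Complex.ofReal_mul, ih, h1]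
    push_cast
    rfl

lemma hasSum_norm_poch_binomial {s r : ℝ} (hs : 0 ≤ s) (hr0 : 0 ≤ r) (hr : r < 1) :
    HasSum (fun m : ℕ => ‖poch (s : ℂ) m‖ / m.factorial * r ^ m) ((1 - r) ^ (-s)) := by
  have h := hasSum_poch_binomial (s : ℂ) (x := (r : ℂ)) (by simpa [abs_of_nonneg hr0])
  rw [← Complex.hasSum_ofReal]
  convert h using 2 with m
  · push_cast
    rw [norm_poch_ofReal hs]
  · rw [Complex.ofReal_cpow (by linarith)]
    push_cast
    rfl

lemma one_sub_cpow_mul_pow (a x : ℂ) (hx : x ≠ 1) (k : ℕ) :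
    (1 - x) ^ (-(a + 2 * k)) * (-4 * x) ^ k =
      (1 - x) ^ (-a) * (-4 * x / (1 - x) ^ 2) ^ k := by
  have h0 : 1 - x ≠ 0 := sub_ne_zero.mpr hx.symm
  rw [neg_add, Complex.cpow_add _ _ h0, div_pow, Complex.cpow_neg _ (2 * k : ℂ),
    show (2 * k : ℂ) = ((2 * k : ℕ) : ℂ) by push_cast; rfl, Complex.cpow_natCast, pow_mul]
  field_simp

/-- Re-expansion of `(1 - x)⁻ᵃ ∑ Bₖ (-4x/(1-x)²)ᵏ` in powers of `x`, near the origin. -/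
lemma tsum_quadratic_expansion (a : ℂ) {B : ℕ → ℂ} (hB : RatioTendsToOne B) {x : ℂ}
    (hx : ‖x‖ < 1 / 10) :
    (1 - x) ^ (-a) * ∑' k, B k * (-4 * x / (1 - x) ^ 2) ^ k =
      ∑' n, (∑ k ∈ Finset.range (n + 1), B k * (-4) ^ k *
        (poch (a + 2 * k) (n - k) / (n - k).factorial)) * x ^ n := by
  set r := ‖x‖ with hr
  have hr0 : 0 ≤ r := norm_nonneg x
  have hx1 : x ≠ 1 := by rintro rfl; simp at hr; linarith
  let f : ℕ × ℕ → ℂ := fun i => B i.1 * (-4 * x) ^ i.1 *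
    (poch (a + 2 * i.1) i.2 / i.2.factorial * x ^ i.2)
  let g : ℕ × ℕ → ℝ := fun i => ‖B i.1‖ * (4 * r) ^ i.1 *
    (‖poch ((‖a‖ + 2 * i.1 : ℝ) : ℂ) i.2‖ / i.2.factorial * r ^ i.2)
  have hfg (i : ℕ × ℕ) : ‖f i‖ ≤ g i := by
    simp only [f, g, norm_mul, norm_pow, norm_div, norm_neg, Complex.norm_natCast, ← hr]
    rw [show ‖(4 : ℂ)‖ = 4 by simp]
    gcongr
    refine norm_poch_le ((norm_add_le _ _).trans ?_) _
    simp
  have hg0 (i : ℕ × ℕ) : 0 ≤ g i := (norm_nonneg _).trans (hfg i)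
  have hgk (k : ℕ) : HasSum (fun m => g (k, m))
      (‖B k‖ * (4 * r) ^ k * (1 - r) ^ (-(‖a‖ + 2 * k))) :=
    (hasSum_norm_poch_binomial (by positivity) hr0 (by linarith)).mul_left _
  have h1r : 0 < 1 - r := by linarith
  have hgs : Summable g := by
    refine (summable_prod_of_nonneg hg0).mpr ⟨fun k => (hgk k).summable, ?_⟩
    have hw : ‖((4 * r / (1 - r) ^ 2 : ℝ) : ℂ)‖ < 1 := by
      rw [Complex.norm_real, Real.norm_eq_abs, abs_of_nonneg (by positivity), div_lt_one (by positivity)]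
      nlinarith
    refine ((hB.summable hw).norm.mul_left ((1 - r) ^ (-‖a‖))).congr fun k => ?_
    rw [(hgk k).tsum_eq, norm_mul, norm_pow, Complex.norm_real, Real.norm_eq_abs,
      abs_of_nonneg (by positivity), neg_add, Real.rpow_add h1r, Real.rpow_neg h1r.le (2 * k : ℝ),
      show (2 * k : ℝ) = ((2 * k : ℕ) : ℝ) by push_cast; rfl, Real.rpow_natCast, pow_mul, div_pow]
    field_simp
  have hfs : Summable f := Summable.of_norm_bounded hgs hfg
  have hfk (k : ℕ) : HasSum (fun m => f (k, m))
      ((1 - x) ^ (-a) * (B k * (-4 * x / (1 - x) ^ 2) ^ k)) := by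
    have := (hasSum_poch_binomial (a + 2 * k) (x := x) (by rw [← hr]; linarith)).mul_left
      (B k * (-4 * x) ^ k)
    rwa [show B k * (-4 * x) ^ k * (1 - x) ^ (-(a + 2 * k)) =
      (1 - x) ^ (-a) * (B k * (-4 * x / (1 - x) ^ 2) ^ k) by
        linear_combination B k * one_sub_cpow_mul_pow a x hx1 k] at this
  have hsig := Summable.tsum_sigma' (fun n => (hasSum_fintype _).summable)
    (Finset.HasAntidiagonal.sigmaAntidiagonalEquivProd.summable_iff.mpr hfs)
  rw [← tsum_mul_left, ← (hfs.hasSum.prod_fiberwise hfk).tsum_eq.symm,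
    ← Finset.HasAntidiagonal.sigmaAntidiagonalEquivProd.tsum_eq f]
  refine hsig.trans (tsum_congr fun n => ?_)
  rw [tsum_fintype, Finset.sum_mul]
  simp only [Function.comp_apply, Finset.HasAntidiagonal.sigmaAntidiagonalEquivProd_apply]
  rw [Finset.sum_coe_sort (Finset.HasAntidiagonal.antidiagonal n) f,
    Finset.Nat.sum_antidiagonal_eq_sum_range_succ_mk]
  refine Finset.sum_congr rfl fun k hk => ?_
  have hkn : k ≤ n := Nat.lt_succ_iff.mp (Finset.mem_range.mp hk)
  simp only [f]
  rw [mul_pow, show x ^ n = x ^ k * x ^ (n - k) by rw [← pow_add, Nat.add_sub_cancel' hkn]]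
  ring

/-- Coefficients of the well-poised series with parameter pairs `p + 1; p` and `a - p + 1; a - p`. -/
noncomputable def wellPoisedCoeff (a b c p : ℂ) (n : ℕ) : ℂ :=
  poch a n * poch b n * poch c n / (n.factorial * (poch (1 + a - b) n * poch (1 + a - c) n)) *
    ((p + n) * (a - p + n) / (p * (a - p)))

/-- Coefficients of the series in the quadratically transformed variable. -/
noncomputable def quadraticCoeff (a b c γ : ℂ) (k : ℕ) : ℂ :=
  poch (a / 2) k * poch ((a + 1) / 2) k * poch (a - b - c) k /
    (k.factorial * (poch (1 + a - b) k * poch (1 + a - c) k)) * ((γ + k) / γ)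

lemma ratioTendsToOne_wellPoisedCoeff {a b c p : ℂ} (hb : ∀ m : ℕ, 1 + a - b ≠ -(m : ℂ))
    (hc : ∀ m : ℕ, 1 + a - c ≠ -(m : ℂ)) (hp : ∀ m : ℕ, p ≠ -(m : ℂ))
    (hap : ∀ m : ℕ, a - p ≠ -(m : ℂ)) : RatioTendsToOne (wellPoisedCoeff a b c p) := by
  refine ⟨fun n => (a + n) / (1 + n) * ((b + n) / (1 + a - b + n)) * ((c + n) / (1 + a - c + n)) *
    ((p + 1 + n) / (p + n)) * ((a - p + 1 + n) / (a - p + n)), ?_, .of_forall fun n => ?_⟩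
  · simpa using ((((tendsto_add_div_add a 1).mul (tendsto_add_div_add b (1 + a - b))).mul
      (tendsto_add_div_add c (1 + a - c))).mul (tendsto_add_div_add (p + 1) p)).mul
      (tendsto_add_div_add (a - p + 1) (a - p))
  · have h1 := poch_ne_zero hb n
    have h2 := poch_ne_zero hc n
    have h3 := add_natCast_ne_zero hb n
    have h4 := add_natCast_ne_zero hc n
    have h5 := add_natCast_ne_zero hp n
    have h6 := add_natCast_ne_zero hap n
    have h7 : p ≠ 0 := by simpa using hp 0
    have h8 : a - p ≠ 0 := by simpa using hap 0
    have h9 : (n.factorial : ℂ) ≠ 0 := by exact_mod_cast n.factorial_ne_zero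
    have h10 : (1 : ℂ) + n ≠ 0 := by rw [add_comm]; exact Nat.cast_add_one_ne_zero n
    simp only [wellPoisedCoeff, poch_succ, Nat.factorial_succ]
    rw [Nat.cast_mul, Nat.cast_succ, add_comm (n : ℂ) 1]
    field_simp
    ring

lemma ratioTendsToOne_quadraticCoeff {a b c γ : ℂ} (hb : ∀ m : ℕ, 1 + a - b ≠ -(m : ℂ))
    (hc : ∀ m : ℕ, 1 + a - c ≠ -(m : ℂ)) (hγ : ∀ m : ℕ, γ ≠ -(m : ℂ)) :
    RatioTendsToOne (quadraticCoeff a b c γ) := by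
  refine ⟨fun n => (a / 2 + n) / (1 + n) * (((a + 1) / 2 + n) / (1 + a - b + n)) *
    ((a - b - c + n) / (1 + a - c + n)) * ((γ + 1 + n) / (γ + n)), ?_, .of_forall fun n => ?_⟩
  · simpa using (((tendsto_add_div_add (a / 2) 1).mul
      (tendsto_add_div_add ((a + 1) / 2) (1 + a - b))).mul
      (tendsto_add_div_add (a - b - c) (1 + a - c))).mul (tendsto_add_div_add (γ + 1) γ)
  · have h1 := poch_ne_zero hb n
    have h2 := poch_ne_zero hc n
    have h3 := add_natCast_ne_zero hb n
    have h4 := add_natCast_ne_zero hc n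
    have h5 := add_natCast_ne_zero hγ n
    have h7 : γ ≠ 0 := by simpa using hγ 0
    have h9 : (n.factorial : ℂ) ≠ 0 := by exact_mod_cast n.factorial_ne_zero
    have h10 : (1 : ℂ) + n ≠ 0 := by rw [add_comm]; exact Nat.cast_add_one_ne_zero n
    simp only [quadraticCoeff, poch_succ, Nat.factorial_succ]
    rw [Nat.cast_mul, Nat.cast_succ, add_comm (n : ℂ) 1]
    field_simp
    ring

lemma sum_quadraticCoeff (a b c p γ : ℂ) (hbc : b * c - p * (a - p) ≠ 0)
    (hγ : γ = p * (a - p) * (b + c - a) / (b * c - p * (a - p))) (hγ0 : γ ≠ 0)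
    (hb : ∀ m : ℕ, 1 + a - b ≠ -(m : ℂ)) (hc : ∀ m : ℕ, 1 + a - c ≠ -(m : ℂ)) (n : ℕ) :
    ∑ k ∈ Finset.range (n + 1), quadraticCoeff a b c γ k * (-4) ^ k *
      (poch (a + 2 * k) (n - k) / (n - k).factorial) = wellPoisedCoeff a b c p n := by
  have h := congrArg (poch a n / n.factorial * ·) (sum_saal_extra a b c p γ hbc hγ hγ0 hb hc n)
  have hn : (n.factorial : ℂ) ≠ 0 := by exact_mod_cast n.factorial_ne_zero
  have hRHS : wellPoisedCoeff a b c p n = poch a n / n.factorial *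
      (poch b n * poch c n / (poch (1 + a - b) n * poch (1 + a - c) n) *
        ((p + n) * (a - p + n) / (p * (a - p)))) := by
    have h1 := poch_ne_zero hb n
    have h2 := poch_ne_zero hc n
    rw [wellPoisedCoeff]
    ring
  rw [hRHS, ← h]
  simp only [Finset.mul_sum]
  refine Finset.sum_congr rfl fun k hk => ?_
  have hkn : k ≤ n := Nat.lt_succ_iff.mp (Finset.mem_range.mp hk)
  have h1 := poch_ne_zero hb k
  have h2 := poch_ne_zero hc k
  have h3 : (k.factorial : ℂ) ≠ 0 := by exact_mod_cast k.factorial_ne_zero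
  have h4 : ((n - k).factorial : ℂ) ≠ 0 := by exact_mod_cast (n - k).factorial_ne_zero
  have h5 : (n.choose k : ℂ) = n.factorial / (k.factorial * (n - k).factorial) :=
    Nat.cast_choose ℂ hkn
  have h6 : poch a n * poch (a + n) k =
      4 ^ k * (poch (a / 2) k * poch ((a + 1) / 2) k) * poch (a + 2 * k) (n - k) := by
    rw [← poch_add, ← poch_two_mul, show n + k = 2 * k + (n - k) by omega, poch_add]
    push_cast
    rfl
  have h7 : (-4 : ℂ) ^ k = (-1) ^ k * 4 ^ k := by rw [← mul_pow]; norm_num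
  rw [quadraticCoeff, h5, h7]
  field_simp
  linear_combination -poch (a - b - c) k * (γ + k) * h6

lemma four_mul_abs_lt {x : ℝ} (hx1 : -1 < x) (hx2 : x < 3 - 2 * Real.sqrt 2) :
    x < 1 ∧ 4 * |x| < (1 - x) ^ 2 := by
  have h2 : Real.sqrt 2 ^ 2 = 2 := Real.sq_sqrt (by norm_num)
  have h3 : 1 < Real.sqrt 2 := by rw [Real.lt_sqrt] <;> norm_num
  refine ⟨by linarith, ?_⟩
  rcases abs_cases x with ⟨h, h'⟩ | ⟨h, h'⟩
  · rw [h]; nlinarith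
  · rw [h]; nlinarith

lemma norm_quadratic_lt_one {x : ℝ} (hx1 : -1 < x) (hx2 : x < 3 - 2 * Real.sqrt 2) :
    ‖-4 * (x : ℂ) / (1 - (x : ℂ)) ^ 2‖ < 1 := by
  obtain ⟨h1, h2⟩ := four_mul_abs_lt hx1 hx2
  have h : (-4 * (x : ℂ) / (1 - (x : ℂ)) ^ 2) = ((-4 * x / (1 - x) ^ 2 : ℝ) : ℂ) := by push_cast; rfl
  have h3 : 0 < (1 - x) ^ 2 := pow_pos (by linarith) 2
  rw [h, Complex.norm_real, Real.norm_eq_abs, abs_div, abs_mul, abs_of_pos h3, div_lt_one h3]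
  simpa using h2

/-- The quadratic transformation on the real interval `(-1, 3 - 2√2)`. -/
lemma tsum_wellPoisedCoeff_eq (a b c p γ : ℂ) (hbc : b * c - p * (a - p) ≠ 0)
    (hγ : γ = p * (a - p) * (b + c - a) / (b * c - p * (a - p)))
    (hb : ∀ m : ℕ, 1 + a - b ≠ -(m : ℂ)) (hc : ∀ m : ℕ, 1 + a - c ≠ -(m : ℂ))
    (hp : ∀ m : ℕ, p ≠ -(m : ℂ)) (hap : ∀ m : ℕ, a - p ≠ -(m : ℂ))
    (hγn : ∀ m : ℕ, γ ≠ -(m : ℂ)) {x : ℝ} (hx1 : -1 < x) (hx2 : x < 3 - 2 * Real.sqrt 2) :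
    ∑' n, wellPoisedCoeff a b c p n * (x : ℂ) ^ n =
      (1 - (x : ℂ)) ^ (-a) *
        ∑' k, quadraticCoeff a b c γ k * (-4 * (x : ℂ) / (1 - (x : ℂ)) ^ 2) ^ k := by
  have hA := ratioTendsToOne_wellPoisedCoeff hb hc hp hap
  have hB := ratioTendsToOne_quadraticCoeff hb hc hγn
  have hs : Real.sqrt 2 < 3 / 2 := by rw [Real.sqrt_lt'] <;> norm_num
  let U : Set ℂ := Set.image Complex.ofReal (Set.Ioo (-1) (3 - 2 * Real.sqrt 2))
  have hF : AnalyticOnNhd ℂ (fun z => ∑' n, wellPoisedCoeff a b c p n * z ^ n) U := by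
    rintro _ ⟨t, ht, rfl⟩
    refine hA.analyticAt ?_
    rw [Complex.norm_real, Real.norm_eq_abs, abs_lt]
    exact ⟨ht.1, (four_mul_abs_lt ht.1 ht.2).1⟩
  have hG : AnalyticOnNhd ℂ (fun z => (1 - z) ^ (-a) *
      ∑' k, quadraticCoeff a b c γ k * (-4 * z / (1 - z) ^ 2) ^ k) U := by
    rintro _ ⟨t, ht, rfl⟩
    have ht1 := (four_mul_abs_lt ht.1 ht.2).1
    have h0 : (1 : ℂ) - t ∈ Complex.slitPlane := by
      left; simpa using ht1
    have h1 : AnalyticAt ℂ (fun z : ℂ => 1 - z) t := by fun_prop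
    refine (h1.cpow analyticAt_const h0).mul ?_
    refine AnalyticAt.fun_comp (f := fun z : ℂ => -4 * z / (1 - z) ^ 2)
      (hB.analyticAt (norm_quadratic_lt_one ht.1 ht.2)) ?_
    exact (analyticAt_const.mul analyticAt_id).div (h1.pow 2)
      (pow_ne_zero _ (Complex.slitPlane_ne_zero h0))
  refine hF.eqOn_of_preconnected_of_eventuallyEq hG
    (isPreconnected_Ioo.image _ Complex.continuous_ofReal.continuousOn) (z₀ := 0)
    ⟨0, ⟨by norm_num, by linarith⟩, by simp⟩ ?_ ⟨x, ⟨hx1, hx2⟩, rfl⟩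
  filter_upwards [Metric.ball_mem_nhds (0 : ℂ) (by norm_num : (0 : ℝ) < 1 / 10)] with z hz
  rw [tsum_quadratic_expansion a hB (by simpa using hz)]
  exact tsum_congr fun n => by
    rw [sum_quadraticCoeff a b c p γ hbc hγ (by simpa using hγn 0) hb hc]

lemma hasDerivAt_quadratic {x : ℂ} (hx : 1 - x ≠ 0) :
    HasDerivAt (fun z : ℂ => -4 * z / (1 - z) ^ 2) (-4 * (1 + x) / (1 - x) ^ 3) x := by
  have h := ((hasDerivAt_id x).const_mul (-4)).div (((hasDerivAt_id x).const_sub 1).pow 2)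
    (pow_ne_zero 2 hx)
  refine HasDerivAt.congr_deriv h ?_
  simp only [id, Pi.pow_apply]
  push_cast
  field_simp
  ring

/-- The image of the quadratic transformation under the Euler operator `x d/dx`. -/
lemma tsum_natCast_mul_wellPoisedCoeff_eq (a b c p γ : ℂ) (hbc : b * c - p * (a - p) ≠ 0)
    (hγ : γ = p * (a - p) * (b + c - a) / (b * c - p * (a - p)))
    (hb : ∀ m : ℕ, 1 + a - b ≠ -(m : ℂ)) (hc : ∀ m : ℕ, 1 + a - c ≠ -(m : ℂ))
    (hp : ∀ m : ℕ, p ≠ -(m : ℂ)) (hap : ∀ m : ℕ, a - p ≠ -(m : ℂ))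
    (hγn : ∀ m : ℕ, γ ≠ -(m : ℂ)) {x : ℝ} (hx1 : -1 < x) (hx2 : x < 3 - 2 * Real.sqrt 2) :
    ∑' n : ℕ, n * wellPoisedCoeff a b c p n * (x : ℂ) ^ n =
      (1 - (x : ℂ)) ^ (-a - 1) *
        (a * x * ∑' k, quadraticCoeff a b c γ k * (-4 * (x : ℂ) / (1 - (x : ℂ)) ^ 2) ^ k +
          (1 + x) * ∑' k : ℕ, k * quadraticCoeff a b c γ k *
            (-4 * (x : ℂ) / (1 - (x : ℂ)) ^ 2) ^ k) := by
  have hA := ratioTendsToOne_wellPoisedCoeff hb hc hp hap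
  have hB := ratioTendsToOne_quadraticCoeff hb hc hγn
  have hx := (four_mul_abs_lt hx1 hx2).1
  have hslit : (1 : ℂ) - x ∈ Complex.slitPlane := by left; simpa using hx
  have h0 : (1 : ℂ) - x ≠ 0 := Complex.slitPlane_ne_zero hslit
  have hF := hA.hasDerivAt (z := (x : ℂ)) (by
    rw [Complex.norm_real, Real.norm_eq_abs, abs_lt]; exact ⟨hx1, hx⟩)
  have hH := (hB.hasDerivAt (norm_quadratic_lt_one hx1 hx2)).comp (x : ℂ) (hasDerivAt_quadratic h0)
  have hG := (((hasDerivAt_id (x : ℂ)).const_sub 1).cpow_const (c := -a) hslit).mul hH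
  have hev : (fun t : ℝ => ∑' n, wellPoisedCoeff a b c p n * (t : ℂ) ^ n) =ᶠ[𝓝 x]
      fun t : ℝ => (1 - (t : ℂ)) ^ (-a) *
        ∑' k, quadraticCoeff a b c γ k * (-4 * (t : ℂ) / (1 - (t : ℂ)) ^ 2) ^ k := by
    filter_upwards [Ioo_mem_nhds hx1 hx2] with t ht
    exact tsum_wellPoisedCoeff_eq a b c p γ hbc hγ hb hc hp hap hγn ht.1 ht.2
  have huniq := (hF.comp_ofReal.congr_of_eventuallyEq hev.symm).unique hG.comp_ofReal
  rw [← mul_tsum_deriv, huniq, ← mul_tsum_deriv]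
  simp only [id, Function.comp_apply]
  rw [Complex.cpow_sub _ _ h0, Complex.cpow_one]
  field_simp

theorem proposition_6P1 (a b c p q : ℂ) (hq : q ≠ 0)
    (hbc : b * c - p * (a - p) ≠ 0) (γ : ℂ)
    (hγ : γ = p * (a - p) * (b + c - a) / (b * c - p * (a - p)))
    (hnd : ∀ z ∈ [1 + a - b, 1 + a - c, p, a - p, q, γ], ∀ m : ℕ, z ≠ -(m : ℂ))
    (x : ℝ) (hx1 : -1 < x) (hx2 : x < 3 - 2 * Real.sqrt 2)
    (δ : ℂ) (hδ : δ = (q + (a - q) * (x : ℂ)) / (1 + (x : ℂ)))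
    (hδn : ∀ m : ℕ, δ ≠ -(m : ℂ)) :
    hypSummable [a, b, c, a - p + 1, p + 1, q + 1] [1 + a - b, 1 + a - c, p, a - p, q]
        (x : ℂ) ∧
    hypSummable [a / 2, (a + 1) / 2, a - b - c, γ + 1, δ + 1] [1 + a - b, 1 + a - c, γ, δ]
        (-4 * (x : ℂ) / (1 - (x : ℂ)) ^ 2) ∧
    hypF [a, b, c, a - p + 1, p + 1, q + 1] [1 + a - b, 1 + a - c, p, a - p, q] (x : ℂ)
      = (1 + (a - q) / q * (x : ℂ)) * (1 - (x : ℂ)) ^ (-a - 1) *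
        hypF [a / 2, (a + 1) / 2, a - b - c, γ + 1, δ + 1] [1 + a - b, 1 + a - c, γ, δ]
          (-4 * (x : ℂ) / (1 - (x : ℂ)) ^ 2) := by
  have hb : ∀ m : ℕ, 1 + a - b ≠ -(m : ℂ) := hnd _ (by simp)
  have hc : ∀ m : ℕ, 1 + a - c ≠ -(m : ℂ) := hnd _ (by simp)
  have hp : ∀ m : ℕ, p ≠ -(m : ℂ) := hnd _ (by simp)
  have hap : ∀ m : ℕ, a - p ≠ -(m : ℂ) := hnd _ (by simp)
  have hqn : ∀ m : ℕ, q ≠ -(m : ℂ) := hnd _ (by simp)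
  have hγn : ∀ m : ℕ, γ ≠ -(m : ℂ) := hnd _ (by simp)
  have hp0 : p ≠ 0 := by simpa using hp 0
  have hap0 : a - p ≠ 0 := by simpa using hap 0
  have hγ0 : γ ≠ 0 := by simpa using hγn 0
  have hδ0 : δ ≠ 0 := by simpa using hδn 0
  have hA := ratioTendsToOne_wellPoisedCoeff hb hc hp hap
  have hB := ratioTendsToOne_quadraticCoeff hb hc hγn
  have hx := (four_mul_abs_lt hx1 hx2).1
  have hx' : ‖(x : ℂ)‖ < 1 := by
    rw [Complex.norm_real, Real.norm_eq_abs, abs_lt]; exact ⟨hx1, hx⟩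
  have hy := norm_quadratic_lt_one hx1 hx2
  have hL (n : ℕ) : ([a, b, c, a - p + 1, p + 1, q + 1].map fun a => poch a n).prod /
      ((n.factorial : ℂ) * ([1 + a - b, 1 + a - c, p, a - p, q].map fun b => poch b n).prod) *
        (x : ℂ) ^ n = wellPoisedCoeff a b c p n * (x : ℂ) ^ n +
          q⁻¹ * (n * wellPoisedCoeff a b c p n * (x : ℂ) ^ n) := by
    have h1 := poch_ne_zero hb n
    have h2 := poch_ne_zero hc n
    have h3 := poch_ne_zero hp n
    have h4 := poch_ne_zero hap n
    have h5 := poch_ne_zero hqn n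
    have h6 : (n.factorial : ℂ) ≠ 0 := by exact_mod_cast n.factorial_ne_zero
    simp only [List.map_cons, List.map_nil, List.prod_cons, List.prod_nil, poch_add_one hap,
      poch_add_one hp, poch_add_one hqn, wellPoisedCoeff]
    field_simp
  have hR (k : ℕ) : ([a / 2, (a + 1) / 2, a - b - c, γ + 1, δ + 1].map fun a => poch a k).prod /
      ((k.factorial : ℂ) * ([1 + a - b, 1 + a - c, γ, δ].map fun b => poch b k).prod) *
        (-4 * (x : ℂ) / (1 - (x : ℂ)) ^ 2) ^ k =
      quadraticCoeff a b c γ k * (-4 * (x : ℂ) / (1 - (x : ℂ)) ^ 2) ^ k +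
        δ⁻¹ * (k * quadraticCoeff a b c γ k * (-4 * (x : ℂ) / (1 - (x : ℂ)) ^ 2) ^ k) := by
    generalize -4 * (x : ℂ) / (1 - (x : ℂ)) ^ 2 = y
    have h1 := poch_ne_zero hb k
    have h2 := poch_ne_zero hc k
    have h3 := poch_ne_zero hγn k
    have h4 := poch_ne_zero hδn k
    have h6 : (k.factorial : ℂ) ≠ 0 := by exact_mod_cast k.factorial_ne_zero
    simp only [List.map_cons, List.map_nil, List.prod_cons, List.prod_nil, poch_add_one hγn,
      poch_add_one hδn, quadraticCoeff]
    field_simp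
  have hA1 := hA.summable hx'
  have hA2 := (hA.natCast_mul.summable hx').mul_left q⁻¹
  have hB1 := hB.summable hy
  have hB2 := (hB.natCast_mul.summable hy).mul_left δ⁻¹
  refine ⟨(hA1.add hA2).congr fun n => (hL n).symm, (hB1.add hB2).congr fun n => (hR n).symm, ?_⟩
  rw [hypF, hypF, tsum_congr hL, tsum_congr hR, hA1.tsum_add hA2, hB1.tsum_add hB2, tsum_mul_left,
    tsum_mul_left, tsum_wellPoisedCoeff_eq a b c p γ hbc hγ hb hc hp hap hγn hx1 hx2,
    tsum_natCast_mul_wellPoisedCoeff_eq a b c p γ hbc hγ hb hc hp hap hγn hx1 hx2]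
  generalize ∑' k, quadraticCoeff a b c γ k * (-4 * (x : ℂ) / (1 - (x : ℂ)) ^ 2) ^ k = H
  generalize ∑' k : ℕ, k * quadraticCoeff a b c γ k * (-4 * (x : ℂ) / (1 - (x : ℂ)) ^ 2) ^ k = K
  have h0 : (1 : ℂ) - x ≠ 0 := by
    rw [← Complex.ofReal_one, ← Complex.ofReal_sub]
    exact_mod_cast (sub_pos.mpr hx).ne'
  have h1 : (1 : ℂ) + x ≠ 0 := by
    rw [← Complex.ofReal_one, ← Complex.ofReal_add]
    exact_mod_cast (by linarith : (1 : ℝ) + x ≠ 0)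
  have hδ' : q + (a - q) * x = δ * (1 + x) := by rw [hδ]; field_simp
  have hpref : 1 + (a - q) / q * x = δ * (1 + x) / q := by rw [← hδ']; field_simp
  rw [hpref, Complex.cpow_sub _ _ h0, Complex.cpow_one]
  field_simp
  linear_combination (1 - (x : ℂ)) ^ (-a) * H * hδ'
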